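/- arXiv:1607.06764 — 7 statements merged into one kernel-verified Lean document; each statement's English description precedes it below -/
import Mathlib

section
/- Fix N ≥ 1, L > 0, R > 0, and a unit vector ν ∈ ℝ^d. Define the Huber-type function ψ(x) = (L·R/(N+1))‖x‖ − L·R²/(2(N+1)²) if ‖x‖ ≥ R/(N+1), and ψ(x) = (L/2)‖x‖² if ‖x‖ < R/(N+1). Then ψ is convex and continuously differentiable with L-Lipschitz gradient, its minimizer is 0 (so ‖x_0 − 0‖ = R for x_0 = Rν), and the gradient method iterates started at x_0 = Rν satisfy x_i = (1 − i/(N+1))Rν and ∇ψ(x_i) = (L·R/(N+1))ν for all i = 0,...,N; in particular ‖∇ψ(x_i)‖ = L·R/(N+1) for all i = 0,...,N. -/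
section Huber

open Asymptotics Topology

variable {E : Type*} [NormedAddCommGroup E] [InnerProductSpace ℝ E]

/-- The radial projection onto the closed ball of radius `r` centred at the origin. -/
noncomputable def ballProj (r : ℝ) (z : E) : E := if r ≤ ‖z‖ then (r / ‖z‖) • z else z

/-- The Huber function with threshold `r` and unit curvature. -/
noncomputable def huber (r : ℝ) (z : E) : ℝ :=
  if r ≤ ‖z‖ then r * ‖z‖ - r ^ 2 / 2 else ‖z‖ ^ 2 / 2

theorem norm_ballProj_le {r : ℝ} (hr : 0 < r) (z : E) : ‖ballProj r z‖ ≤ r := by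
  unfold ballProj
  split_ifs with h
  · have hz : 0 < ‖z‖ := hr.trans_le h
    rw [norm_smul, Real.norm_of_nonneg (by positivity), div_mul_cancel₀ _ hz.ne']
  · exact (not_le.mp h).le

theorem huber_eq_inner_ballProj {r : ℝ} (hr : 0 < r) (z : E) :
    huber r z = inner ℝ (ballProj r z) z - ‖ballProj r z‖ ^ 2 / 2 := by
  unfold huber ballProj
  split_ifs with h
  · have hz : 0 < ‖z‖ := hr.trans_le h
    rw [norm_smul, Real.norm_of_nonneg (by positivity), div_mul_cancel₀ _ hz.ne',
      real_inner_smul_left, real_inner_self_eq_norm_sq]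
    field_simp
  · rw [real_inner_self_eq_norm_sq]
    ring

theorem inner_sub_le_huber {r : ℝ} {p : E} (hp : ‖p‖ ≤ r) (w : E) :
    inner ℝ p w - ‖p‖ ^ 2 / 2 ≤ huber r w := by
  have h1 := real_inner_le_norm p w
  unfold huber
  split_ifs with h
  · nlinarith [mul_nonneg (sub_nonneg.2 hp) (sub_nonneg.2 h), sq_nonneg (r - ‖p‖)]
  · nlinarith [sq_nonneg (‖w‖ - ‖p‖)]

theorem huber_add_inner_le {r : ℝ} (hr : 0 < r) (z w : E) :
    huber r z + inner ℝ (ballProj r z) (w - z) ≤ huber r w := by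
  have h := inner_sub_le_huber (norm_ballProj_le hr z) w
  rw [huber_eq_inner_ballProj hr z, inner_sub_right]
  linarith

theorem inner_sub_ballProj_nonpos {r : ℝ} (hr : 0 < r) (z : E) {p : E} (hp : ‖p‖ ≤ r) :
    inner ℝ (z - ballProj r z) (p - ballProj r z) ≤ 0 := by
  unfold ballProj
  split_ifs with h
  · have hz : 0 < ‖z‖ := hr.trans_le h
    have h1 : inner ℝ z p ≤ r * ‖z‖ :=
      (real_inner_le_norm z p).trans (by nlinarith)
    have h2 : r / ‖z‖ ≤ 1 := (div_le_one hz).2 h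
    have h3 : inner ℝ (z - (r / ‖z‖) • z) (p - (r / ‖z‖) • z)
        = (1 - r / ‖z‖) * (inner ℝ z p - r * ‖z‖) := by
      simp only [inner_sub_left, inner_sub_right, real_inner_smul_left, real_inner_smul_right]
      rw [real_inner_self_eq_norm_sq]
      field_simp
    rw [h3]
    exact mul_nonpos_of_nonneg_of_nonpos (by linarith) (by linarith)
  · simp

theorem norm_ballProj_sub_le {r : ℝ} (hr : 0 < r) (z w : E) :
    ‖ballProj r z - ballProj r w‖ ≤ ‖z - w‖ := by
  have h1 := inner_sub_ballProj_nonpos hr z (norm_ballProj_le hr w)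
  have h2 := inner_sub_ballProj_nonpos hr w (norm_ballProj_le hr z)
  have h3 : ‖ballProj r z - ballProj r w‖ ^ 2 ≤ inner ℝ (z - w) (ballProj r z - ballProj r w) := by
    rw [← real_inner_self_eq_norm_sq]
    simp only [inner_sub_left, inner_sub_right] at h1 h2 ⊢
    linarith
  have h4 := real_inner_le_norm (z - w) (ballProj r z - ballProj r w)
  by_contra! h
  nlinarith [norm_nonneg (z - w)]

theorem convexOn_huber {r : ℝ} (hr : 0 < r) : ConvexOn ℝ Set.univ (huber r : E → ℝ) := by
  refine ⟨convex_univ, fun x _ y _ a b ha hb hab => ?_⟩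
  have hx := mul_le_mul_of_nonneg_left (huber_add_inner_le hr (a • x + b • y) x) ha
  have hy := mul_le_mul_of_nonneg_left (huber_add_inner_le hr (a • x + b • y) y) hb
  simp only [smul_eq_mul]
  simp only [inner_sub_right, inner_add_right, real_inner_smul_right] at hx hy
  obtain rfl : b = 1 - a := by linarith
  linarith

theorem hasGradientAt_huber [CompleteSpace E] {r : ℝ} (hr : 0 < r) (z : E) :
    HasGradientAt (huber r) (ballProj r z) z := by
  rw [hasGradientAt_iff_isLittleO]
  have hO : (fun w => huber r w - huber r z - inner ℝ (ballProj r z) (w - z))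
      =O[𝓝 z] fun w => ‖w - z‖ ^ 2 := by
    refine IsBigO.of_bound 1 (Filter.Eventually.of_forall fun w => ?_)
    have h1 := huber_add_inner_le hr z w
    have h2 := huber_add_inner_le hr w z
    have h3 := real_inner_le_norm (ballProj r w - ballProj r z) (w - z)
    have h4 := mul_le_mul_of_nonneg_right (norm_ballProj_sub_le hr w z) (norm_nonneg (w - z))
    rw [Real.norm_of_nonneg (by linarith), norm_pow, norm_norm, one_mul]
    rw [← neg_sub w z, inner_neg_right] at h2
    rw [inner_sub_left] at h3
    linarith
  refine hO.trans_isLittleO ?_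
  simpa using isLittleO_pow_sub_sub z one_lt_two

end Huber

theorem stmt_1 {d : ℕ} (L R : ℝ) (hL : 0 < L) (hR : 0 < R)
    (N : ℕ) (hN : 1 ≤ N)
    (ν : EuclideanSpace ℝ (Fin d)) (hν : ‖ν‖ = 1)
    (ψ : EuclideanSpace ℝ (Fin d) → ℝ)
    (hψ : ∀ z, ψ z =
      if R / ((N : ℝ) + 1) ≤ ‖z‖ then
        L * R / ((N : ℝ) + 1) * ‖z‖ - L * R ^ 2 / (2 * ((N : ℝ) + 1) ^ 2)
      else L / 2 * ‖z‖ ^ 2)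
    (x : ℕ → EuclideanSpace ℝ (Fin d))
    (hx0 : x 0 = R • ν)
    (hrec : ∀ i, x (i + 1) = x i - (1 / L) • gradient ψ (x i)) :
    ConvexOn ℝ Set.univ ψ ∧
    (∀ z, HasGradientAt ψ (gradient ψ z) z) ∧
    (∀ z w, ‖gradient ψ z - gradient ψ w‖ ≤ L * ‖z - w‖) ∧
    (∀ z, ψ 0 ≤ ψ z) ∧
    (∀ i ≤ N, x i = ((1 : ℝ) - (i : ℝ) / ((N : ℝ) + 1)) • (R • ν)) ∧
    (∀ i ≤ N, gradient ψ (x i) = (L * R / ((N : ℝ) + 1)) • ν) ∧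
    (∀ i ≤ N, ‖gradient ψ (x i)‖ = L * R / ((N : ℝ) + 1)) := by
  have hn : (0 : ℝ) < (N : ℝ) + 1 := by positivity
  set r : ℝ := R / ((N : ℝ) + 1) with hr_def
  have hr : 0 < r := by positivity
  have hψ' : ψ = fun z => L * huber r z := by
    funext z
    rw [hψ, huber]
    split_ifs
    · rw [hr_def]
      field_simp
    · ring
  have hg : ∀ z, HasGradientAt ψ (L • ballProj r z) z := fun z => by
    rw [hψ', hasGradientAt_iff_hasFDerivAt]
    simpa using (hasGradientAt_huber hr z).hasFDerivAt.const_mul L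
  have hgrad : ∀ z, gradient ψ z = L • ballProj r z := fun z => (hg z).gradient
  have hcoef : ∀ i : ℕ, ((1 : ℝ) - (i : ℝ) / ((N : ℝ) + 1)) • (R • ν)
      = (((N : ℝ) + 1 - i) * r) • ν := fun i => by
    rw [smul_smul, hr_def]
    congr 1
    field_simp
  have hproj : ∀ i ≤ N, ballProj r ((((N : ℝ) + 1 - i) * r) • ν) = r • ν := fun i hi => by
    have hi' : (i : ℝ) ≤ N := by exact_mod_cast hi
    have hpos : 0 < (N : ℝ) + 1 - i := by linarith
    have hnorm : ‖(((N : ℝ) + 1 - i) * r) • ν‖ = ((N : ℝ) + 1 - i) * r := by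
      rw [norm_smul, hν, mul_one, Real.norm_of_nonneg (by positivity)]
    rw [ballProj, hnorm, if_pos (by nlinarith), smul_smul, div_mul_cancel₀ _ (by positivity)]
  have hx : ∀ i ≤ N, x i = (((N : ℝ) + 1 - i) * r) • ν := fun i => by
    induction i with
    | zero =>
      intro _
      rw [hx0, hr_def]
      congr 1
      push_cast
      field_simp
      ring
    | succ k ih =>
      intro hk
      rw [hrec, hgrad, ih (by omega), hproj k (by omega), smul_smul, one_div,
        inv_mul_cancel₀ hL.ne', one_smul, ← sub_smul]
      congr 1
      push_cast
      ring
  have hgx : ∀ i ≤ N, gradient ψ (x i) = (L * R / ((N : ℝ) + 1)) • ν := fun i hi => by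
    rw [hgrad, hx i hi, hproj i hi, smul_smul, hr_def, mul_div_assoc]
  refine ⟨?_, fun z => (hgrad z).symm ▸ hg z, fun z w => ?_, fun z => ?_,
    fun i hi => (hx i hi).trans (hcoef i).symm, hgx, fun i hi => ?_⟩
  · rw [hψ']
    exact (convexOn_huber hr).smul hL.le
  · rw [hgrad, hgrad, ← smul_sub, norm_smul, Real.norm_of_nonneg hL.le]
    exact mul_le_mul_of_nonneg_left (norm_ballProj_sub_le hr z w) hL.le
  · have h := huber_add_inner_le hr 0 z
    have h0 : ballProj r (0 : EuclideanSpace ℝ (Fin d)) = 0 := by simp [ballProj]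
    rw [h0, inner_zero_left, add_zero] at h
    rw [hψ']
    exact mul_le_mul_of_nonneg_left h hL.le
  · rw [hgx i hi, norm_smul, hν, mul_one, Real.norm_of_nonneg (by positivity)]
end

section
/- Let θ_0, θ_1, ..., θ_N be positive reals with θ_0 = 1 and let Θ_0, ..., Θ_N be positive reals. Define step coefficients h_{i+1,k} for i = 0,...,N−1 by h_{i+1,i} = 1 + (2θ_i − 1)θ_{i+1}/Θ_{i+1} and, for k = 0,...,i−1, h_{i+1,k} = (θ_{i+1}/Θ_{i+1})(2θ_k − Σ_{j=k+1}^{i} h_{j,k}). Then these coefficients satisfy the recursion: h_{i+1,k} = ((Θ_i − θ_i)θ_{i+1}/(θ_i Θ_{i+1})) h_{i,k} for k = 0,...,i−2; h_{i+1,i−1} = ((Θ_i − θ_i)θ_{i+1}/(θ_i Θ_{i+1}))(h_{i,i−1} − 1); and h_{i+1,i} = 1 + (2θ_i − 1)θ_{i+1}/Θ_{i+1}. -/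
theorem stmt_4 (N : ℕ) (θ Θ : ℕ → ℝ)
    (hθ0 : θ 0 = 1) (hθpos : ∀ i, 0 < θ i) (hΘpos : ∀ i, 0 < Θ i)
    (h : ℕ → ℕ → ℝ)
    (hdiag : ∀ i, i < N → h (i + 1) i = 1 + (2 * θ i - 1) * θ (i + 1) / Θ (i + 1))
    (hoff : ∀ i, i < N → ∀ k, k < i →
      h (i + 1) k = (θ (i + 1) / Θ (i + 1)) *
        (2 * θ k - ∑ j ∈ Finset.Icc (k + 1) i, h j k)) :
    (∀ i, i < N → ∀ k, k + 2 ≤ i →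
      h (i + 1) k = ((Θ i - θ i) * θ (i + 1) / (θ i * Θ (i + 1))) * h i k) ∧
    (∀ i, i + 2 ≤ N →
      h (i + 2) i = ((Θ (i + 1) - θ (i + 1)) * θ (i + 2) / (θ (i + 1) * Θ (i + 2)))
        * (h (i + 1) i - 1)) ∧
    (∀ i, i < N → h (i + 1) i = 1 + (2 * θ i - 1) * θ (i + 1) / Θ (i + 1)) := by
  refine ⟨fun i hi k hk => ?_, fun i hi => ?_, hdiag⟩
  · obtain ⟨m, rfl⟩ : ∃ m, i = m + 1 := ⟨i - 1, by omega⟩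
    have hsum := Finset.sum_Icc_succ_top (show k + 1 ≤ m + 1 by omega) fun j => h j k
    rw [hoff (m + 1) hi k (by omega), hsum, hoff m (by omega) k (by omega)]
    have hθ := (hθpos (m + 1)).ne'
    have hΘ := (hΘpos (m + 1)).ne'
    have hΘ' := (hΘpos (m + 1 + 1)).ne'
    field_simp
    ring
  · rw [hoff (i + 1) (by omega) i (by omega), Finset.Icc_self, Finset.sum_singleton,
      hdiag i (by omega)]
    have hθ := (hθpos (i + 1)).ne'
    have hΘ := (hΘpos (i + 1)).ne'
    have hΘ' := (hΘpos (i + 2)).ne'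
    field_simp
    ring
end

section
/- Let f : ℝ^d → ℝ be convex and continuously differentiable with L-Lipschitz gradient (L > 0). Let θ_0 = Θ_0 = 1 and let θ_i, Θ_i be positive reals. Let h_{i+1,k} satisfy the recursion h_{i+1,k} = ((Θ_i − θ_i)θ_{i+1}/(θ_i Θ_{i+1})) h_{i,k} for k ≤ i−2, h_{i+1,i−1} = ((Θ_i − θ_i)θ_{i+1}/(θ_i Θ_{i+1}))(h_{i,i−1} − 1), and h_{i+1,i} = 1 + (2θ_i − 1)θ_{i+1}/Θ_{i+1}. Then the sequence produced by the fixed-step first-order method x_{i+1} = x_i − (1/L)Σ_{k=0}^{i} h_{i+1,k} ∇f(x_k), started at x_0, coincides with the sequence produced by GOGM1: y_0 = x_0; y_{i+1} = x_i − (1/L)∇f(x_i); x_{i+1} = y_{i+1} + ((Θ_i − θ_i)θ_{i+1}/(θ_i Θ_{i+1}))(y_{i+1} − y_i) + ((2θ_i² − Θ_i)θ_{i+1}/(θ_i Θ_{i+1}))(y_{i+1} − x_i). -/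
/-- If the coefficients `b` agree with `c • a` below `i` and with `c * (a i - 1)` at `i`, then the
`b`-weighted sum over `range (i + 2)` is obtained from the `a`-weighted sum over `range (i + 1)`. -/
theorem sum_smul_succ_eq_smul_sum_sub {R M : Type*} [Ring R] [AddCommGroup M] [Module R M]
    {a b : ℕ → R} {c : R} {i : ℕ} (hlt : ∀ k < i, b k = c * a k) (hi : b i = c * (a i - 1))
    (g : ℕ → M) :
    ∑ k ∈ Finset.range (i + 2), b k • g k =
      c • (∑ k ∈ Finset.range (i + 1), a k • g k - g i) + b (i + 1) • g (i + 1) := by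
  have hsum : ∑ k ∈ Finset.range i, b k • g k = c • ∑ k ∈ Finset.range i, a k • g k := by
    rw [Finset.smul_sum]
    refine Finset.sum_congr rfl fun k hk => ?_
    rw [hlt k (Finset.mem_range.mp hk), mul_smul]
  rw [Finset.sum_range_succ, Finset.sum_range_succ, Finset.sum_range_succ _ i, hsum, hi,
    mul_smul, sub_smul, one_smul, add_sub_assoc, smul_add]

theorem stmt_5 {d : ℕ} (L : ℝ) (hL : 0 < L)
    (f : EuclideanSpace ℝ (Fin d) → ℝ)
    (f' : EuclideanSpace ℝ (Fin d) → EuclideanSpace ℝ (Fin d))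
    (hconv : ConvexOn ℝ Set.univ f)
    (hdiff : ∀ z, HasGradientAt f (f' z) z)
    (hlip : ∀ z w, ‖f' z - f' w‖ ≤ L * ‖z - w‖)
    (θ Θ : ℕ → ℝ) (hθ0 : θ 0 = 1) (hΘ0 : Θ 0 = 1)
    (hθpos : ∀ i, 0 < θ i) (hΘpos : ∀ i, 0 < Θ i)
    (h : ℕ → ℕ → ℝ)
    (hrec1 : ∀ i k, k + 2 ≤ i →
      h (i + 1) k = ((Θ i - θ i) * θ (i + 1) / (θ i * Θ (i + 1))) * h i k)
    (hrec2 : ∀ i, h (i + 2) i =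
      ((Θ (i + 1) - θ (i + 1)) * θ (i + 2) / (θ (i + 1) * Θ (i + 2))) * (h (i + 1) i - 1))
    (hrec3 : ∀ i, h (i + 1) i = 1 + (2 * θ i - 1) * θ (i + 1) / Θ (i + 1))
    (x0 : EuclideanSpace ℝ (Fin d))
    (x y xg : ℕ → EuclideanSpace ℝ (Fin d))
    (hx0 : x 0 = x0)
    (hxrec : ∀ i, x (i + 1) = x i -
      (1 / L) • ∑ k ∈ Finset.range (i + 1), h (i + 1) k • f' (x k))
    (hxg0 : xg 0 = x0) (hy0 : y 0 = x0)
    (hyrec : ∀ i, y (i + 1) = xg i - (1 / L) • f' (xg i))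
    (hxgrec : ∀ i, xg (i + 1) = y (i + 1)
        + ((Θ i - θ i) * θ (i + 1) / (θ i * Θ (i + 1))) • (y (i + 1) - y i)
        + ((2 * θ i ^ 2 - Θ i) * θ (i + 1) / (θ i * Θ (i + 1))) • (y (i + 1) - xg i)) :
    ∀ i, x i = xg i := by
  have hsum : ∀ i, ∑ k ∈ Finset.range (i + 2), h (i + 2) k • f' (x k) =
      ((Θ (i + 1) - θ (i + 1)) * θ (i + 2) / (θ (i + 1) * Θ (i + 2))) •
        (∑ k ∈ Finset.range (i + 1), h (i + 1) k • f' (x k) - f' (x i)) +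
      h (i + 2) (i + 1) • f' (x (i + 1)) := fun i =>
    sum_smul_succ_eq_smul_sum_sub (fun k hk => hrec1 (i + 1) k (by omega)) (hrec2 i) _
  have hcoef : ∀ i, h (i + 1) i = 1 + (Θ i - θ i) * θ (i + 1) / (θ i * Θ (i + 1)) +
      (2 * θ i ^ 2 - Θ i) * θ (i + 1) / (θ i * Θ (i + 1)) := by
    intro i
    have hθi := (hθpos i).ne'
    have hΘi := (hΘpos (i + 1)).ne'
    rw [hrec3]
    field_simp
    ring
  intro i
  induction i using Nat.twoStepInduction with
  | zero => rw [hx0, hxg0]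
  | one =>
    have h0 := hcoef 0
    rw [hxrec, hxgrec, hyrec, hy0, hxg0, hx0, Finset.sum_range_one, h0, hθ0, hΘ0, hx0]
    module
  | more i ih₀ ih₁ =>
    have hx := hxrec i
    rw [hxrec (i + 1), hxgrec, hyrec (i + 1), hyrec i, ← ih₀, ← ih₁, hsum, hcoef (i + 1)]
    generalize ∑ k ∈ Finset.range (i + 1), h (i + 1) k • f' (x k) = S at hx ⊢
    generalize f' (x (i + 1)) = g
    rw [hx]
    module
end

section
/- Let f : ℝ^d → ℝ be convex and continuously differentiable with L-Lipschitz gradient (L > 0). Let θ_0 = Θ_0 = 1 and let θ_i, Θ_i be positive reals. Define step coefficients by h_{i+1,i} = 1 + (2θ_i − 1)θ_{i+1}/Θ_{i+1} and h_{i+1,k} = (θ_{i+1}/Θ_{i+1})(2θ_k − Σ_{j=k+1}^{i} h_{j,k}) for k = 0,...,i−1. Then the sequence produced by the fixed-step first-order method x_{i+1} = x_i − (1/L)Σ_{k=0}^{i} h_{i+1,k} ∇f(x_k), started at x_0, coincides with the sequence produced by GOGM2: y_0 = x_0; y_{i+1} = x_i − (1/L)∇f(x_i); z_{i+1} = x_0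 − (1/L)Σ_{k=0}^{i} 2θ_k ∇f(x_k); x_{i+1} = (1 − θ_{i+1}/Θ_{i+1}) y_{i+1} + (θ_{i+1}/Θ_{i+1}) z_{i+1}. -/
/-- Unrolling a fixed-step first-order method: after `i` steps the direction `g k` has been
subtracted with the accumulated coefficient `∑ j ∈ Icc (k + 1) i, h j k`. -/
theorem fixedStep_eq_sub_sum {R E : Type*} [Ring R] [AddCommGroup E] [Module R E]
    (c : R) (h : ℕ → ℕ → R) (x g : ℕ → E)
    (hx : ∀ i, x (i + 1) = x i - c • ∑ k ∈ Finset.range (i + 1), h (i + 1) k • g k) (i : ℕ) :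
    x i = x 0 - c • ∑ k ∈ Finset.range i, (∑ j ∈ Finset.Icc (k + 1) i, h j k) • g k := by
  induction i with
  | zero => simp
  | succ i ih =>
    have hsum : ∑ k ∈ Finset.range (i + 1), (∑ j ∈ Finset.Icc (k + 1) (i + 1), h j k) • g k =
        ∑ k ∈ Finset.range i, (∑ j ∈ Finset.Icc (k + 1) i, h j k) • g k +
          ∑ k ∈ Finset.range (i + 1), h (i + 1) k • g k := by
      rw [Finset.sum_range_succ, Finset.sum_range_succ _ i, ← add_assoc,
        ← Finset.sum_add_distrib, Finset.Icc_self, Finset.sum_singleton]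
      congr 1
      refine Finset.sum_congr rfl fun k hk => ?_
      have hki : k + 1 ≤ i + 1 := by grind
      rw [Finset.sum_Icc_succ_top hki, add_smul]
    rw [hx, hsum, smul_add, ← sub_sub, ← ih]


theorem stmt_6 {d : ℕ} (L : ℝ) (hL : 0 < L)
    (f : EuclideanSpace ℝ (Fin d) → ℝ)
    (f' : EuclideanSpace ℝ (Fin d) → EuclideanSpace ℝ (Fin d))
    (hconv : ConvexOn ℝ Set.univ f)
    (hdiff : ∀ z, HasGradientAt f (f' z) z)
    (hlip : ∀ z w, ‖f' z - f' w‖ ≤ L * ‖z - w‖)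
    (θ Θ : ℕ → ℝ) (hθ0 : θ 0 = 1) (hΘ0 : Θ 0 = 1)
    (hθpos : ∀ i, 0 < θ i) (hΘpos : ∀ i, 0 < Θ i)
    (h : ℕ → ℕ → ℝ)
    (hdiag : ∀ i, h (i + 1) i = 1 + (2 * θ i - 1) * θ (i + 1) / Θ (i + 1))
    (hoff : ∀ i, ∀ k, k < i → h (i + 1) k = (θ (i + 1) / Θ (i + 1)) *
        (2 * θ k - ∑ j ∈ Finset.Icc (k + 1) i, h j k))
    (x0 : EuclideanSpace ℝ (Fin d))
    (x y z xg : ℕ → EuclideanSpace ℝ (Fin d))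
    (hx0 : x 0 = x0)
    (hxrec : ∀ i, x (i + 1) = x i -
      (1 / L) • ∑ k ∈ Finset.range (i + 1), h (i + 1) k • f' (x k))
    (hxg0 : xg 0 = x0) (hy0 : y 0 = x0)
    (hyrec : ∀ i, y (i + 1) = xg i - (1 / L) • f' (xg i))
    (hzrec : ∀ i, z (i + 1) = x0 -
      (1 / L) • ∑ k ∈ Finset.range (i + 1), (2 * θ k) • f' (xg k))
    (hxgrec : ∀ i, xg (i + 1) = ((1 : ℝ) - θ (i + 1) / Θ (i + 1)) • y (i + 1)
        + (θ (i + 1) / Θ (i + 1)) • z (i + 1)) :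
    ∀ i, x i = xg i := by
  intro i
  induction i using Nat.strong_induction_on with
  | _ i ih =>
    cases i with
    | zero => rw [hx0, hxg0]
    | succ i =>
      have hz : z (i + 1) = x0 -
          (1 / L) • ∑ k ∈ Finset.range (i + 1), (2 * θ k) • f' (x k) := by
        rw [hzrec]
        congr 2
        exact Finset.sum_congr rfl fun k hk => by rw [ih k (Finset.mem_range.mp hk)]
      have hunroll := fixedStep_eq_sub_sum (1 / L) h x (fun k => f' (x k)) hxrec i
      have hsum : ∑ k ∈ Finset.range i, h (i + 1) k • f' (x k) =
          (θ (i + 1) / Θ (i + 1)) • (∑ k ∈ Finset.range i, (2 * θ k) • f' (x k) -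
            ∑ k ∈ Finset.range i, (∑ j ∈ Finset.Icc (k + 1) i, h j k) • f' (x k)) := by
        rw [← Finset.sum_sub_distrib, Finset.smul_sum]
        refine Finset.sum_congr rfl fun k hk => ?_
        rw [hoff i k (Finset.mem_range.mp hk), mul_smul, sub_smul]
      rw [hxgrec, hz, hyrec, ← ih i i.lt_succ_self, hxrec, Finset.sum_range_succ, hsum, hdiag,
        Finset.sum_range_succ, mul_div_assoc]
      rw [hx0] at hunroll
      linear_combination (norm := module) (θ (i + 1) / Θ (i + 1)) • hunroll
end

section
/- Let f be in the class F and let y_0, ..., y_N be generated by GOGM (with parameters θ_i satisfying θ_0 = 1, θ_i > 0, and θ_i² ≤ Θ_i, where Θ_i = Σ_{l=0}^{i} θ_l for i ≤ N−1 and Θ_N = 2Σ_{l=0}^{N−1} θ_l + θ_N). Then for any 1 ≤ i ≤ N, f(y_i) − f(x_*) ≤ L·R² / (4Θ_{i−1}). -/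
section SmoothConvex

variable {E : Type*} [NormedAddCommGroup E] [InnerProductSpace ℝ E]
  {f : E → ℝ} {f' : E → E} {L : ℝ}

lemma half_mul_norm_sub_smul_sq (hL : 0 < L) (s : ℝ) (g u v : E) :
    L / 2 * ‖u - (2 * s / L) • g - v‖ ^ 2 = L / 2 * ‖u - v‖ ^ 2 -
      2 * s * (inner ℝ g u - inner ℝ g v) + 2 * s ^ 2 * (‖g‖ ^ 2 / L) := by
  rw [sub_right_comm, norm_sub_sq_real, real_inner_smul_right, norm_smul, mul_pow,
    Real.norm_eq_abs, sq_abs, real_inner_comm, inner_sub_right]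
  field_simp

variable [CompleteSpace E]

lemma HasGradientAt.hasDerivAt_comp_lineMap (hdiff : ∀ z, HasGradientAt f (f' z) z)
    (z w : E) (t : ℝ) :
    HasDerivAt (fun t : ℝ => f (AffineMap.lineMap z w t))
      (inner ℝ (f' (AffineMap.lineMap z w t)) (w - z)) t := by
  have h := (hdiff (AffineMap.lineMap z w t)).hasFDerivAt.comp_hasDerivAt t
    (AffineMap.hasDerivAt_lineMap (a := z) (b := w))
  simpa [Function.comp_def] using! h

/-- A convex function lies above its tangent hyperplanes. -/
lemma ConvexOn.add_inner_gradient_le (hconv : ConvexOn ℝ Set.univ f)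
    (hdiff : ∀ z, HasGradientAt f (f' z) z) (z w : E) :
    f z + inner ℝ (f' z) (w - z) ≤ f w := by
  have hc : ConvexOn ℝ Set.univ (fun t : ℝ => f (AffineMap.lineMap z w t)) :=
    hconv.comp_affineMap (AffineMap.lineMap z w : ℝ →ᵃ[ℝ] E)
  have h := hc.le_slope_of_hasDerivAt (Set.mem_univ 0) (Set.mem_univ 1) one_pos
    (HasGradientAt.hasDerivAt_comp_lineMap hdiff z w 0)
  simp only [slope_def_field, AffineMap.lineMap_apply_zero, AffineMap.lineMap_apply_one,
    sub_zero, div_one] at h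
  linarith

/-- The descent lemma: a function with `L`-Lipschitz gradient lies below its quadratic model. -/
lemma le_add_inner_gradient_add_sq (hdiff : ∀ z, HasGradientAt f (f' z) z)
    (hlip : ∀ z w, ‖f' z - f' w‖ ≤ L * ‖z - w‖) (z w : E) :
    f w ≤ f z + inner ℝ (f' z) (w - z) + L / 2 * ‖w - z‖ ^ 2 := by
  set φ : ℝ → ℝ := fun t => f (AffineMap.lineMap z w t) -
    (t * inner ℝ (f' z) (w - z) + t ^ 2 * (L / 2 * ‖w - z‖ ^ 2))
  have hφ (t : ℝ) : HasDerivAt φ (inner ℝ (f' (AffineMap.lineMap z w t)) (w - z) -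
      (1 * inner ℝ (f' z) (w - z) + 2 * t * (L / 2 * ‖w - z‖ ^ 2))) t := by
    refine (HasGradientAt.hasDerivAt_comp_lineMap hdiff z w t).sub
      (((hasDerivAt_id t).mul_const _).add (HasDerivAt.mul_const ?_ _))
    simpa using hasDerivAt_pow 2 t
  have hanti : AntitoneOn φ (Set.Icc 0 1) := by
    refine antitoneOn_of_deriv_nonpos (convex_Icc 0 1)
      (fun t _ => (hφ t).continuousAt.continuousWithinAt)
      (fun t _ => (hφ t).differentiableAt.differentiableWithinAt) fun t ht => ?_
    rw [interior_Icc] at ht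
    have hcs := real_inner_le_norm (f' (AffineMap.lineMap z w t) - f' z) (w - z)
    have hl := hlip (AffineMap.lineMap z w t) z
    rw [← dist_eq_norm (AffineMap.lineMap z w t), dist_lineMap_left, dist_eq_norm,
      Real.norm_of_nonneg ht.1.le, norm_sub_rev z w] at hl
    have := mul_le_mul_of_nonneg_right hl (norm_nonneg (w - z))
    rw [(hφ t).deriv]
    rw [inner_sub_left] at hcs
    linarith
  have h := hanti (Set.left_mem_Icc.2 zero_le_one) (Set.right_mem_Icc.2 zero_le_one) zero_le_one
  simp only [φ, AffineMap.lineMap_apply_zero, AffineMap.lineMap_apply_one] at h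
  linarith

/-- A gradient step of length `1 / L` decreases the function by at least `‖∇f‖² / (2 * L)`. -/
lemma apply_sub_gradient_le (hL : 0 < L) (hdiff : ∀ z, HasGradientAt f (f' z) z)
    (hlip : ∀ z w, ‖f' z - f' w‖ ≤ L * ‖z - w‖) (z : E) :
    f (z - (1 / L) • f' z) ≤ f z - ‖f' z‖ ^ 2 / L / 2 := by
  have h := le_add_inner_gradient_add_sq hdiff hlip z (z - (1 / L) • f' z)
  rw [sub_sub_cancel_left, inner_neg_right, real_inner_smul_right, real_inner_self_eq_norm_sq,
    norm_neg, norm_smul, Real.norm_of_nonneg (by positivity)] at h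
  refine h.trans_eq ?_
  field_simp
  ring

/-- The interpolation inequality for convex functions with `L`-Lipschitz gradient. -/
lemma ConvexOn.add_inner_gradient_add_sq_le (hL : 0 < L) (hconv : ConvexOn ℝ Set.univ f)
    (hdiff : ∀ z, HasGradientAt f (f' z) z)
    (hlip : ∀ z w, ‖f' z - f' w‖ ≤ L * ‖z - w‖) (a b : E) :
    f b + inner ℝ (f' b) (a - b) + ‖f' a - f' b‖ ^ 2 / L / 2 ≤ f a := by
  have h₁ := hconv.add_inner_gradient_le hdiff b (a - (1 / L) • (f' a - f' b))
  have h₂ := le_add_inner_gradient_add_sq hdiff hlip a (a - (1 / L) • (f' a - f' b))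
  have h₃ : inner ℝ (f' a) (f' a - f' b) - inner ℝ (f' b) (f' a - f' b) =
      ‖f' a - f' b‖ ^ 2 := by
    rw [← inner_sub_left, real_inner_self_eq_norm_sq]
  rw [sub_right_comm, inner_sub_right, real_inner_smul_right] at h₁
  rw [sub_sub_cancel_left, inner_neg_right, real_inner_smul_right, norm_neg, norm_smul,
    Real.norm_of_nonneg (by positivity)] at h₂
  have h₄ : L / 2 * (1 / L * ‖f' a - f' b‖) ^ 2 = ‖f' a - f' b‖ ^ 2 / L / 2 := by
    field_simp
  have h₅ : 1 / L * inner ℝ (f' a) (f' a - f' b) - 1 / L * inner ℝ (f' b) (f' a - f' b) =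
      ‖f' a - f' b‖ ^ 2 / L := by
    rw [← mul_sub, h₃]; ring
  linarith

/-- One GOGM step does not increase the potential
`2 * Θ * (f x - ‖∇f x‖² / (2 * L) - f x_*) + (L / 2) * ‖z - x_*‖²`. -/
lemma gogm_potential_step (hL : 0 < L) (hconv : ConvexOn ℝ Set.univ f)
    (hdiff : ∀ z, HasGradientAt f (f' z) z)
    (hlip : ∀ z w, ‖f' z - f' w‖ ≤ L * ‖z - w‖)
    {xs : E} (hgrad : f' xs = 0) {T s : ℝ} (hT : 0 ≤ T) (hs : 0 ≤ s) (hsT : s ^ 2 ≤ T + s)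
    {x z x₁ : E} (hx₁ : (T + s) • x₁ = T • (x - (1 / L) • f' x) + s • z) :
    2 * (T + s) * (f x₁ - ‖f' x₁‖ ^ 2 / L / 2 - f xs) +
        L / 2 * ‖z - (2 * s / L) • f' x₁ - xs‖ ^ 2 ≤
      2 * T * (f x - ‖f' x‖ ^ 2 / L / 2 - f xs) + L / 2 * ‖z - xs‖ ^ 2 := by
  have h₁ := hconv.add_inner_gradient_add_sq_le hL hdiff hlip x x₁
  have h₂ := hconv.add_inner_gradient_add_sq_le hL hdiff hlip xs x₁
  rw [hgrad, zero_sub, norm_neg, inner_sub_right] at h₂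
  have h₃ := congrArg (inner ℝ (f' x₁)) hx₁
  simp only [inner_add_right, real_inner_smul_right, inner_sub_right] at h₃
  rw [norm_sub_sq_real, inner_sub_right, real_inner_comm (f' x₁) (f' x)] at h₁
  rw [half_mul_norm_sub_smul_sq hL]
  have h₄ : (‖f' x‖ ^ 2 - 2 * inner ℝ (f' x₁) (f' x) + ‖f' x₁‖ ^ 2) / L / 2 =
      ‖f' x‖ ^ 2 / L / 2 - 1 / L * inner ℝ (f' x₁) (f' x) + ‖f' x₁‖ ^ 2 / L / 2 := by
    ring
  rw [h₄] at h₁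
  have h₅ := mul_nonneg (sub_nonneg.2 hsT) (div_nonneg (sq_nonneg ‖f' x₁‖) hL.le)
  have h₆ := mul_le_mul_of_nonneg_left h₁ hT
  have h₇ := mul_le_mul_of_nonneg_left h₂ hs
  linarith

end SmoothConvex

theorem stmt_7 {d : ℕ} (L R : ℝ) (hL : 0 < L) (hR : 0 < R)
    (f : EuclideanSpace ℝ (Fin d) → ℝ)
    (f' : EuclideanSpace ℝ (Fin d) → EuclideanSpace ℝ (Fin d))
    (hconv : ConvexOn ℝ Set.univ f)
    (hdiff : ∀ z, HasGradientAt f (f' z) z)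
    (hlip : ∀ z w, ‖f' z - f' w‖ ≤ L * ‖z - w‖)
    (xs : EuclideanSpace ℝ (Fin d)) (hmin : ∀ z, f xs ≤ f z)
    (N : ℕ)
    (θ Θ : ℕ → ℝ)
    (hθ0 : θ 0 = 1) (hθpos : ∀ i, i ≤ N → 0 < θ i)
    (hΘ : ∀ i, i < N → Θ i = ∑ l ∈ Finset.range (i + 1), θ l)
    (hΘN : Θ N = 2 * ∑ l ∈ Finset.range N, θ l + θ N)
    (hθΘ : ∀ i, i ≤ N → θ i ^ 2 ≤ Θ i)
    (x y : ℕ → EuclideanSpace ℝ (Fin d)) (x0 : EuclideanSpace ℝ (Fin d))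
    (hx0 : x 0 = x0) (hy0 : y 0 = x0) (hinit : ‖x0 - xs‖ ≤ R)
    (hy : ∀ i, i < N → y (i + 1) = x i - (1 / L) • f' (x i))
    (hx : ∀ i, i < N → x (i + 1) = y (i + 1)
        + ((Θ i - θ i) * θ (i + 1) / (θ i * Θ (i + 1))) • (y (i + 1) - y i)
        + ((2 * θ i ^ 2 - Θ i) * θ (i + 1) / (θ i * Θ (i + 1))) • (y (i + 1) - x i)) :
    ∀ i, i < N → f (y (i + 1)) - f xs ≤ L * R ^ 2 / (4 * Θ i) := by
  have hgrad : f' xs = 0 := by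
    have h := (IsLocalMin.hasFDerivAt_eq_zero (Filter.Eventually.of_forall hmin)
      (hdiff xs).hasFDerivAt)
    simpa using h
  have hsucc (k : ℕ) (hk : k + 1 < N) : Θ (k + 1) = Θ k + θ (k + 1) := by
    rw [hΘ _ hk, hΘ k (by omega), Finset.sum_range_succ]
  have hΘpos (k : ℕ) (hk : k < N) : 0 < Θ k :=
    (pow_pos (hθpos k hk.le) 2).trans_le (hθΘ k hk.le)
  have potential (k : ℕ) (hk : k < N) : ∃ z,
      Θ k • x k = (Θ k - θ k) • y k + θ k • z ∧
      2 * Θ k * (f (x k) - ‖f' (x k)‖ ^ 2 / L / 2 - f xs) +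
        L / 2 * ‖z - (2 * θ k / L) • f' (x k) - xs‖ ^ 2 ≤ L / 2 * ‖x0 - xs‖ ^ 2 := by
    induction k with
    | zero =>
      have hΘ0 : Θ 0 = 0 + θ 0 := by simp [hΘ 0 hk]
      refine ⟨x0, by rw [hx0, hy0, ← add_smul, sub_add_cancel], ?_⟩
      have h := gogm_potential_step hL hconv hdiff hlip hgrad (T := 0) (s := θ 0) (x := x 0)
        (z := x0) (x₁ := x 0) le_rfl (hθpos 0 hk.le).le (hΘ0 ▸ hθΘ 0 hk.le)
        (by rw [zero_smul, zero_add, zero_add, hx0])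
      rw [hΘ0]
      linarith
    | succ k ih =>
      obtain ⟨z, hz, hpot⟩ := ih (by omega)
      have hθk := (hθpos k (by omega)).ne'
      have hΘk := (hΘpos _ hk).ne'
      have hcomb : Θ (k + 1) • x (k + 1) = (Θ (k + 1) - θ (k + 1)) • y (k + 1) +
          θ (k + 1) • (z - (2 * θ k / L) • f' (x k)) := by
        have hz' : z = (θ k)⁻¹ • (Θ k • x k - (Θ k - θ k) • y k) := by
          rw [hz, add_sub_cancel_left, inv_smul_smul₀ hθk]
        rw [hx k (by omega), hz', hy k (by omega)]
        match_scalars <;> field_simp <;> ring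
      refine ⟨_, hcomb, le_trans ?_ hpot⟩
      rw [hsucc k hk, add_sub_cancel_right, hy k (by omega)] at hcomb
      have h := gogm_potential_step hL hconv hdiff hlip hgrad (hΘpos k (by omega)).le
        (hθpos _ hk.le).le (hsucc k hk ▸ hθΘ _ hk.le) hcomb
      rwa [hsucc k hk]
  intro i hi
  obtain ⟨z, -, hpot⟩ := potential i hi
  have hdesc := apply_sub_gradient_le hL hdiff hlip (x i)
  rw [← hy i hi] at hdesc
  have hR2 : L / 2 * ‖x0 - xs‖ ^ 2 ≤ L / 2 * R ^ 2 := by gcongr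
  have hnn : 0 ≤ L / 2 * ‖z - (2 * θ i / L) • f' (x i) - xs‖ ^ 2 := by positivity
  have hmul := mul_le_mul_of_nonneg_left hdesc (hΘpos i hi).le
  rw [le_div_iff₀ (by linarith [hΘpos i hi])]
  linarith
end

section
/- Let f : ℝ^d → ℝ be convex and continuously differentiable with L-Lipschitz gradient (L > 0). Then for every x ∈ ℝ^d, ‖∇f(x − (1/L)∇f(x))‖ ≤ ‖∇f(x)‖; that is, one gradient step with step size 1/L does not increase the gradient norm. -/
section GradientInequalities

variable {E : Type*} [NormedAddCommGroup E] [InnerProductSpace ℝ E] [CompleteSpace E]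

lemma HasGradientAt.hasDerivAt_comp_add_smul {f : E → ℝ} {g x v : E} {t : ℝ}
    (h : HasGradientAt f g (x + t • v)) :
    HasDerivAt (fun s : ℝ => f (x + s • v)) (inner ℝ g v) t := by
  have hline : HasDerivAt (fun s : ℝ => x + s • v) v t := by
    simpa using ((hasDerivAt_id t).smul_const v).const_add x
  simpa [Function.comp_def] using h.hasFDerivAt.comp_hasDerivAt t hline

/-- A differentiable convex function lies above its tangent planes. -/
lemma ConvexOn.add_inner_le_of_hasGradientAt {f : E → ℝ} {g x : E}
    (hconv : ConvexOn ℝ Set.univ f) (h : HasGradientAt f g x) (y : E) :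
    f x + inner ℝ g (y - x) ≤ f y := by
  have hline : ConvexOn ℝ Set.univ (fun s : ℝ => f (x + s • (y - x))) := by
    have := hconv.comp_affineMap (AffineMap.lineMap x y : ℝ →ᵃ[ℝ] E)
    simpa [Function.comp_def, AffineMap.lineMap_apply, add_comm] using this
  have hderiv : HasDerivAt (fun s : ℝ => f (x + s • (y - x))) (inner ℝ g (y - x)) 0 :=
    HasGradientAt.hasDerivAt_comp_add_smul (by simpa using h)
  have := hline.le_slope_of_hasDerivAt (Set.mem_univ 0) (Set.mem_univ 1) one_pos hderiv
  simp [slope_def_field] at this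
  linarith

/-- The descent lemma for functions with Lipschitz gradient. -/
lemma le_add_inner_add_of_lipschitz_gradient {f : E → ℝ} {f' : E → E} {L : ℝ}
    (hdiff : ∀ z, HasGradientAt f (f' z) z)
    (hlip : ∀ z w, ‖f' z - f' w‖ ≤ L * ‖z - w‖) (x v : E) :
    f (x + v) ≤ f x + inner ℝ (f' x) v + L / 2 * ‖v‖ ^ 2 := by
  have hderiv : ∀ t : ℝ, HasDerivAt
      (fun s : ℝ => f (x + s • v) - s * inner ℝ (f' x) v - s ^ 2 * (L / 2 * ‖v‖ ^ 2))
      (inner ℝ (f' (x + t • v)) v - inner ℝ (f' x) v - 2 * t * (L / 2 * ‖v‖ ^ 2)) t := by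
    intro t
    have h₁ := (hdiff (x + t • v)).hasDerivAt_comp_add_smul
    have h₂ := (hasDerivAt_id t).mul_const (inner ℝ (f' x) v)
    have h₃ := (hasDerivAt_pow 2 t).mul_const (L / 2 * ‖v‖ ^ 2)
    simpa using (h₁.fun_sub h₂).fun_sub h₃
  have hanti := antitoneOn_of_deriv_nonpos (convex_Icc (0 : ℝ) 1)
    (fun t _ => (hderiv t).continuousAt.continuousWithinAt)
    (fun t _ => (hderiv t).differentiableAt.differentiableWithinAt)
    (fun t ht => by
      rw [interior_Icc] at ht
      rw [(hderiv t).deriv, ← inner_sub_left]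
      have h₁ := real_inner_le_norm (f' (x + t • v) - f' x) v
      have h₂ := hlip (x + t • v) x
      rw [add_sub_cancel_left, norm_smul, Real.norm_of_nonneg ht.1.le] at h₂
      nlinarith [mul_le_mul_of_nonneg_right h₂ (norm_nonneg v)])
  have := hanti (Set.left_mem_Icc.2 zero_le_one) (Set.right_mem_Icc.2 zero_le_one) zero_le_one
  simp at this
  linarith

/-- The tangent-plane bound for a convex function with Lipschitz gradient, improved by a multiple
of the squared distance between the gradients. -/
lemma ConvexOn.add_inner_add_le_of_lipschitz_gradient {f : E → ℝ} {f' : E → E} {L : ℝ}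
    (hL : 0 < L) (hconv : ConvexOn ℝ Set.univ f) (hdiff : ∀ z, HasGradientAt f (f' z) z)
    (hlip : ∀ z w, ‖f' z - f' w‖ ≤ L * ‖z - w‖) (x y : E) :
    f x + inner ℝ (f' x) (y - x) + 1 / (2 * L) * ‖f' y - f' x‖ ^ 2 ≤ f y := by
  set w := f' y - f' x with hw
  have hlow := hconv.add_inner_le_of_hasGradientAt (hdiff x) (y + (-(1 / L)) • w)
  have hup := le_add_inner_add_of_lipschitz_gradient hdiff hlip y ((-(1 / L)) • w)
  have hsplit : y + (-(1 / L)) • w - x = (y - x) + (-(1 / L)) • w := by abel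
  have hinner : inner ℝ (f' y) w - inner ℝ (f' x) w = ‖w‖ ^ 2 := by
    rw [← inner_sub_left, ← hw, real_inner_self_eq_norm_sq]
  rw [hsplit, inner_add_right, inner_smul_right] at hlow
  rw [inner_smul_right, norm_smul, mul_pow, Real.norm_eq_abs, sq_abs] at hup
  have hcoeff : L / 2 * ((-(1 / L)) ^ 2 * ‖w‖ ^ 2) = 1 / (2 * L) * ‖w‖ ^ 2 := by
    field_simp
  have hscaled : 1 / L * (inner ℝ (f' y) w - inner ℝ (f' x) w)
      = 2 * (1 / (2 * L) * ‖w‖ ^ 2) := by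
    rw [hinner]
    field_simp
  linarith

/-- Cocoercivity of the gradient (the Baillon–Haddad theorem). -/
lemma ConvexOn.norm_sq_le_inner_of_lipschitz_gradient {f : E → ℝ} {f' : E → E} {L : ℝ}
    (hL : 0 < L) (hconv : ConvexOn ℝ Set.univ f) (hdiff : ∀ z, HasGradientAt f (f' z) z)
    (hlip : ∀ z w, ‖f' z - f' w‖ ≤ L * ‖z - w‖) (x y : E) :
    1 / L * ‖f' x - f' y‖ ^ 2 ≤ inner ℝ (f' x - f' y) (x - y) := by
  have hxy := hconv.add_inner_add_le_of_lipschitz_gradient hL hdiff hlip x y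
  have hyx := hconv.add_inner_add_le_of_lipschitz_gradient hL hdiff hlip y x
  rw [norm_sub_rev, ← neg_sub x y, inner_neg_right] at hxy
  have hhalf : 1 / L * ‖f' x - f' y‖ ^ 2 = 2 * (1 / (2 * L) * ‖f' x - f' y‖ ^ 2) := by
    field_simp
  rw [inner_sub_left]
  linarith

end GradientInequalities

lemma norm_le_of_norm_sub_sq_le_inner {E : Type*} [NormedAddCommGroup E] [InnerProductSpace ℝ E]
    {a b : E} (h : ‖a - b‖ ^ 2 ≤ inner ℝ (a - b) a) : ‖b‖ ≤ ‖a‖ := by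
  rw [norm_sub_sq_real, inner_sub_left, real_inner_self_eq_norm_sq, real_inner_comm a b] at h
  have hcs := real_inner_le_norm a b
  by_contra! hlt
  nlinarith [norm_nonneg a]

theorem stmt_15 {d : ℕ} (L : ℝ) (hL : 0 < L)
    (f : EuclideanSpace ℝ (Fin d) → ℝ)
    (f' : EuclideanSpace ℝ (Fin d) → EuclideanSpace ℝ (Fin d))
    (hconv : ConvexOn ℝ Set.univ f)
    (hdiff : ∀ z, HasGradientAt f (f' z) z)
    (hlip : ∀ z w, ‖f' z - f' w‖ ≤ L * ‖z - w‖) :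
    ∀ x : EuclideanSpace ℝ (Fin d), ‖f' (x - (1 / L) • f' x)‖ ≤ ‖f' x‖ := by
  intro x
  have h := hconv.norm_sq_le_inner_of_lipschitz_gradient hL hdiff hlip x (x - (1 / L) • f' x)
  rw [sub_sub_cancel, inner_smul_right] at h
  exact norm_le_of_norm_sub_sq_le_inner (le_of_mul_le_mul_left h (one_div_pos.2 hL))
end

section
/- Fix N ≥ 1, let m = ⌈N/2⌉, and define t_0 = 1, t_i = (1 + √(1 + 4t_{i−1}²))/2 for i = 1,...,m−1, and t_i = (N − i + 1)/2 for i = m,...,N. With T_i := Σ_{l=0}^{i} t_l, the following hold: t_i² = T_i for i ≤ m−1 (indeed t_m² = T_m when m ≥ 1 is interpreted via t_{m}² = T_{m} for the Nesterov part, i.e., T_i = t_i² for all i ≤ m where t_m denotes the last Nesterov value), T_N ≥ (2N² + 8N + 9)/16, and Σ_{k=0}^{N}(T_k − t_k²) ≥ N²(N+1)/24. -/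
/-- One step of the Nesterov recursion `s = (1 + √(1 + 4 a²)) / 2` solves `s² = a² + s`. -/
theorem nesterov_step_sq (a : ℝ) :
    ((1 + Real.sqrt (1 + 4 * a ^ 2)) / 2) ^ 2 =
      a ^ 2 + (1 + Real.sqrt (1 + 4 * a ^ 2)) / 2 := by
  have h := Real.sq_sqrt (show (0 : ℝ) ≤ 1 + 4 * a ^ 2 by positivity)
  linear_combination h / 4

theorem add_half_le_nesterov_step (a : ℝ) :
    a + 1 / 2 ≤ (1 + Real.sqrt (1 + 4 * a ^ 2)) / 2 := by
  have h : 2 * a ≤ Real.sqrt (1 + 4 * a ^ 2) := Real.le_sqrt_of_sq_le (by nlinarith)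
  linarith

theorem stmt_18 (N : ℕ) (hN : 1 ≤ N) (m : ℕ) (hm : m = (N + 1) / 2)
    (t T : ℕ → ℝ) (ht0 : t 0 = 1)
    (htrec : ∀ i, i + 2 ≤ m → t (i + 1) = (1 + Real.sqrt (1 + 4 * t i ^ 2)) / 2)
    (htlin : ∀ i, m ≤ i → i ≤ N → t i = ((N : ℝ) - (i : ℝ) + 1) / 2)
    (hT : ∀ i, T i = ∑ l ∈ Finset.range (i + 1), t l) :
    (∀ i, i < m → t i ^ 2 = T i) ∧
    (2 * (N : ℝ) ^ 2 + 8 * (N : ℝ) + 9) / 16 ≤ T N ∧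
    (N : ℝ) ^ 2 * ((N : ℝ) + 1) / 24 ≤ ∑ k ∈ Finset.range (N + 1), (T k - t k ^ 2) := by
  have hTsucc (i : ℕ) : T (i + 1) = T i + t (i + 1) := by
    rw [hT, hT, Finset.sum_range_succ]
  have hsq : ∀ i, i < m → t i ^ 2 = T i := by
    intro i
    induction i with
    | zero => intro _; simp [hT, ht0]
    | succ i ih =>
      intro hi
      rw [hTsucc, ← ih (by omega), htrec i (by omega), nesterov_step_sq]
  have hge : ∀ i, i < m → ((i : ℝ) + 2) / 2 ≤ t i := by
    intro i
    induction i with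
    | zero => intro _; simp [ht0]
    | succ i ih =>
      intro hi
      have h := add_half_le_nesterov_step (t i)
      rw [← htrec i (by omega)] at h
      have := ih (by omega)
      push_cast
      linarith
  obtain ⟨p, rfl⟩ : ∃ p, m = p + 1 := ⟨m - 1, by omega⟩
  obtain ⟨n, rfl⟩ : ∃ n, N = p + n := ⟨N - p, by omega⟩
  have hlin (j : ℕ) (hj : j < n) : t (p + j + 1) = ((n : ℝ) - j) / 2 := by
    rw [htlin _ (by omega) (by omega)]
    push_cast
    ring
  have htail : ∀ j, j ≤ n → T (p + j) = T p + j * (2 * n - j + 1) / 4 := by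
    intro j
    induction j with
    | zero => intro _; simp
    | succ j ih =>
      intro hj
      rw [← add_assoc, hTsucc, ih (by omega), hlin j hj]
      push_cast
      ring
  have hsum : ∀ q, q ≤ n → ∑ k ∈ Finset.range (p + q + 1), (T k - t k ^ 2) =
      q * (T p - ((n : ℝ) + 1) ^ 2 / 4) + (4 * n + 3) * q * (q + 1) / 8
        - q * (q + 1) * (2 * q + 1) / 12 := by
    intro q
    induction q with
    | zero =>
      intro _
      simp only [Nat.cast_zero, zero_mul, zero_div, add_zero, mul_zero, sub_zero]
      refine Finset.sum_eq_zero fun k hk => ?_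
      rw [hsq k (Finset.mem_range.mp hk), sub_self]
    | succ q ih =>
      intro hq
      rw [← add_assoc, Finset.sum_range_succ, ih (by omega), hlin q hq,
        add_assoc p q 1, htail (q + 1) hq]
      push_cast
      ring
  have hTp : ((p : ℝ) + 2) ^ 2 / 4 ≤ T p := by
    have := hge p (by omega)
    rw [← hsq p (by omega)]
    nlinarith [(Nat.cast_nonneg p : (0 : ℝ) ≤ p)]
  refine ⟨hsq, ?_, ?_⟩
  · rw [htail n le_rfl]
    obtain rfl | rfl : n = p + 1 ∨ n = p + 2 := by omega
    all_goals
      push_cast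
      nlinarith [(Nat.cast_nonneg p : (0 : ℝ) ≤ p)]
  · rw [hsum n le_rfl]
    have hp : (0 : ℝ) ≤ p := Nat.cast_nonneg p
    have hmul := mul_le_mul_of_nonneg_left hTp (Nat.cast_nonneg n : (0 : ℝ) ≤ n)
    obtain rfl | rfl : n = p + 1 ∨ n = p + 2 := by omega
    all_goals
      push_cast at hmul ⊢
      nlinarith [mul_nonneg hp hp, mul_nonneg hp (mul_nonneg hp hp)]
end
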